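/- Let A₁, A₂ ∈ ℝ^{n×n}, let θ₁, θ₂ : P → ℝ, and set A(μ) = θ₁(μ)A₁ + θ₂(μ)A₂. Fix μ₀, μ₁, μ ∈ P such that A(μ₀), A(μ₁), and A(μ) are invertible, and assume θ₁(μ₀)θ₂(μ₁) − θ₂(μ₀)θ₁(μ₁) ≠ 0 and θ₁(μ₀)θ₂(μ) − θ₂(μ₀)θ₁(μ) ≠ 0. Let B = A(μ₀)⁻¹, let M ∈ ℝ^{n×n} be symmetric positive definite, let f ∈ ℝⁿ, u_μ = A(μ)⁻¹f, and K_m = K_m(BA(μ₁), Bf) for an integer m ≥ 1. Define γ(μ) = inf over v ≠ 0 of (BA(μ)v, v)_M / (v, v)_M and Γ(μ) = sup over w ≠ 0 of ‖BA(μ)w‖_M / ‖w‖_M, and assume γ(μ) > 0. If û_μ ∈ K_m minimizes ‖Bf − BA(μ)v‖_M over v ∈ K_m, then ‖BA(μ)(u_μ − û_μ)‖_M ≤ (1 − γ(μ)²/Γ(μ)²)^{m/2} · ‖Bf‖_M. -/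

import Mathlib

open Matrix

/-- Krylov subspace `K_m(C, v) = span {v, Cv, ..., C^{m-1} v}`. -/
noncomputable def krylov {n : ℕ} (C : Matrix (Fin n) (Fin n) ℝ) (v : Fin n → ℝ) (m : ℕ) :
    Submodule ℝ (Fin n → ℝ) :=
  Submodule.span ℝ {w | ∃ k < m, w = (C ^ k) *ᵥ v}

/-- The `M`-norm `‖v‖_M = √(vᵀ M v)`. -/
noncomputable def mnorm {n : ℕ} (M : Matrix (Fin n) (Fin n) ℝ) (v : Fin n → ℝ) : ℝ :=
  Real.sqrt (v ⬝ᵥ M *ᵥ v)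

lemma krylov_mono {n : ℕ} (C : Matrix (Fin n) (Fin n) ℝ) (g : Fin n → ℝ) {k l : ℕ}
    (h : k ≤ l) : krylov C g k ≤ krylov C g l :=
  Submodule.span_mono fun _ ⟨j, hj, hw⟩ => ⟨j, hj.trans_le h, hw⟩

lemma mulVec_mem_krylov_succ {n : ℕ} (C : Matrix (Fin n) (Fin n) ℝ) (g : Fin n → ℝ) {k : ℕ}
    {v : Fin n → ℝ} (hv : v ∈ krylov C g k) : C *ᵥ v ∈ krylov C g (k + 1) := by
  induction hv using Submodule.span_induction with
  | mem x hx =>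
    obtain ⟨j, hj, rfl⟩ := hx
    exact Submodule.subset_span ⟨j + 1, by omega, by rw [mulVec_mulVec, pow_succ']⟩
  | zero => simp
  | add x y _ _ hx hy => rw [mulVec_add]; exact add_mem hx hy
  | smul a x _ hx => rw [mulVec_smul]; exact Submodule.smul_mem _ _ hx

lemma self_mem_krylov_succ {n : ℕ} (C : Matrix (Fin n) (Fin n) ℝ) (g : Fin n → ℝ) (k : ℕ) :
    g ∈ krylov C g (k + 1) :=
  Submodule.subset_span ⟨0, by omega, by simp⟩

/-- The residual of `k` steps of Richardson iteration for `C = c • 1 + d • D` is attained in the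
Krylov subspace of the shifted matrix `D`. -/
lemma exists_mem_krylov_richardson {n : ℕ} (C D : Matrix (Fin n) (Fin n) ℝ) (c d : ℝ)
    (hC : C = c • (1 : Matrix (Fin n) (Fin n) ℝ) + d • D) (g : Fin n → ℝ) (α : ℝ) (k : ℕ) :
    ∃ v ∈ krylov D g k, g - C *ᵥ v = ((1 - α • C) ^ k) *ᵥ g := by
  induction k with
  | zero => exact ⟨0, zero_mem _, by simp⟩
  | succ k ih =>
    obtain ⟨v, hv, hr⟩ := ih
    have hv' := krylov_mono D g k.le_succ hv
    refine ⟨v + α • (g - C *ᵥ v), ?_, ?_⟩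
    · refine add_mem hv' (Submodule.smul_mem _ _ (sub_mem (self_mem_krylov_succ D g k) ?_))
      rw [hC, add_mulVec, smul_mulVec, smul_mulVec, one_mulVec]
      exact add_mem (Submodule.smul_mem _ _ hv')
        (Submodule.smul_mem _ _ (mulVec_mem_krylov_succ D g hv))
    · rw [pow_succ', ← mulVec_mulVec, ← hr, sub_mulVec, one_mulVec, smul_mulVec, mulVec_add,
        mulVec_smul]
      abel

lemma dotProduct_mulVec_self_sub_smul {n : ℕ} {M : Matrix (Fin n) (Fin n) ℝ}
    (hM : M.IsSymm) (w z : Fin n → ℝ) (α : ℝ) :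
    (w - α • z) ⬝ᵥ M *ᵥ (w - α • z) =
      w ⬝ᵥ M *ᵥ w - 2 * α * (z ⬝ᵥ M *ᵥ w) + α ^ 2 * (z ⬝ᵥ M *ᵥ z) := by
  have h : w ⬝ᵥ M *ᵥ z = z ⬝ᵥ M *ᵥ w := by
    rw [dotProduct_mulVec, ← mulVec_transpose, hM.eq, dotProduct_comm]
  simp only [mulVec_sub, mulVec_smul, sub_dotProduct, dotProduct_sub, smul_dotProduct,
    dotProduct_smul, smul_eq_mul, h]
  ring

theorem stmt9 {n : ℕ} (hn : 0 < n) {P : Type*}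
    (A₁ A₂ : Matrix (Fin n) (Fin n) ℝ) (θ₁ θ₂ : P → ℝ)
    (A : P → Matrix (Fin n) (Fin n) ℝ)
    (hA : ∀ μ', A μ' = θ₁ μ' • A₁ + θ₂ μ' • A₂)
    (μ₀ μ₁ μ : P)
    (h0 : IsUnit (A μ₀)) (h1 : IsUnit (A μ₁)) (hμ : IsUnit (A μ))
    (hdet1 : θ₁ μ₀ * θ₂ μ₁ - θ₂ μ₀ * θ₁ μ₁ ≠ 0)
    (hdet2 : θ₁ μ₀ * θ₂ μ - θ₂ μ₀ * θ₁ μ ≠ 0)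
    (B : Matrix (Fin n) (Fin n) ℝ) (hB : B = (A μ₀)⁻¹)
    (M : Matrix (Fin n) (Fin n) ℝ) (hM : M.PosDef)
    (f u : Fin n → ℝ) (hu : u = (A μ)⁻¹ *ᵥ f)
    (m : ℕ) (hm : 1 ≤ m)
    (γ Γ : ℝ) (hγpos : 0 < γ)
    -- `γ(μ) = inf_{v ≠ 0} (B A(μ) v, v)_M / (v, v)_M`, expressed as a lower bound
    (hγ : ∀ v : Fin n → ℝ, v ≠ 0 → γ * (v ⬝ᵥ M *ᵥ v) ≤ ((B * A μ) *ᵥ v) ⬝ᵥ M *ᵥ v)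
    -- `Γ(μ) = sup_{w ≠ 0} ‖B A(μ) w‖_M / ‖w‖_M`, expressed as an upper bound
    (hΓ : ∀ w : Fin n → ℝ, mnorm M ((B * A μ) *ᵥ w) ≤ Γ * mnorm M w)
    (uhat : Fin n → ℝ)
    -- `uhat` minimizes `‖Bf − B A(μ) v‖_M` over `K_m = K_m(B A(μ₁), B f)`
    (huhat : uhat ∈ krylov (B * A μ₁) (B *ᵥ f) m)
    (hminz : ∀ v ∈ krylov (B * A μ₁) (B *ᵥ f) m,
      mnorm M (B *ᵥ f - (B * A μ) *ᵥ uhat) ≤ mnorm M (B *ᵥ f - (B * A μ) *ᵥ v)) :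
    mnorm M ((B * A μ) *ᵥ (u - uhat)) ≤
      (1 - γ ^ 2 / Γ ^ 2) ^ ((m : ℝ) / 2) * mnorm M (B *ᵥ f) := by
  have hsymm : M.IsSymm := by simpa [IsHermitian, IsSymm] using hM.1
  have hnn (w : Fin n → ℝ) : 0 ≤ w ⬝ᵥ M *ᵥ w := by
    simpa using hM.posSemidef.dotProduct_mulVec_nonneg w
  have hpos {w : Fin n → ℝ} (hw : w ≠ 0) : 0 < w ⬝ᵥ M *ᵥ w := by
    simpa using hM.dotProduct_mulVec_pos hw
  have h0' : IsUnit (A μ₀).det := (isUnit_iff_isUnit_det _).mp h0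
  have hμ' : IsUnit (A μ).det := (isUnit_iff_isUnit_det _).mp hμ
  have hBA : B * A μ₀ = 1 := by rw [hB, nonsing_inv_mul _ h0']
  set δ := θ₁ μ₀ * θ₂ μ₁ - θ₂ μ₀ * θ₁ μ₁ with hδ
  have hshift : B * A μ = ((θ₁ μ * θ₂ μ₁ - θ₂ μ * θ₁ μ₁) / δ) •
      (1 : Matrix (Fin n) (Fin n) ℝ) +
      ((θ₁ μ₀ * θ₂ μ - θ₂ μ₀ * θ₁ μ) / δ) • (B * A μ₁) := by
    rw [← hBA, ← mul_smul_comm, ← mul_smul_comm, ← mul_add]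
    congr 1
    rw [hA μ, hA μ₀, hA μ₁]
    ext i j
    simp only [Matrix.add_apply, Matrix.smul_apply, smul_eq_mul]
    field_simp
    rw [hδ]
    ring
  have hCu : (B * A μ) *ᵥ u = B *ᵥ f := by
    rw [hu, mulVec_mulVec, mul_assoc, mul_nonsing_inv _ hμ', mul_one]
  set C := B * A μ with hC
  set g := B *ᵥ f with hg
  have hw1 : (fun _ : Fin n => (1 : ℝ)) ≠ 0 := fun h => one_ne_zero (congrFun h ⟨0, hn⟩)
  have hCw1 : C *ᵥ (fun _ => (1 : ℝ)) ≠ 0 := fun h => by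
    have := hγ _ hw1
    rw [h, zero_dotProduct] at this
    exact absurd this (not_le.mpr (mul_pos hγpos (hpos hw1)))
  have hΓpos : 0 < Γ :=
    pos_of_mul_pos_left ((Real.sqrt_pos.mpr (hpos hCw1)).trans_le (hΓ _)) (Real.sqrt_nonneg _)
  have hΓsq (w : Fin n → ℝ) : (C *ᵥ w) ⬝ᵥ M *ᵥ (C *ᵥ w) ≤ Γ ^ 2 * (w ⬝ᵥ M *ᵥ w) := by
    have h := pow_le_pow_left₀ (Real.sqrt_nonneg _) (hΓ w) 2
    unfold mnorm at h
    rwa [mul_pow, Real.sq_sqrt (hnn _), Real.sq_sqrt (hnn _)] at h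
  have hγ' (w : Fin n → ℝ) : γ * (w ⬝ᵥ M *ᵥ w) ≤ (C *ᵥ w) ⬝ᵥ M *ᵥ w := by
    rcases eq_or_ne w 0 with rfl | hw
    · simp
    · exact hγ w hw
  set α := γ / Γ ^ 2 with hα
  have hα0 : 0 ≤ α := by positivity
  set q := 1 - γ ^ 2 / Γ ^ 2 with hq
  have hstep (w : Fin n → ℝ) :
      ((1 - α • C) *ᵥ w) ⬝ᵥ M *ᵥ ((1 - α • C) *ᵥ w) ≤ q * (w ⬝ᵥ M *ᵥ w) := by
    rw [sub_mulVec, one_mulVec, smul_mulVec, dotProduct_mulVec_self_sub_smul hsymm]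
    have e : q = 1 - 2 * α * γ + α ^ 2 * Γ ^ 2 := by
      rw [hq, hα]; field_simp; ring
    rw [e]
    nlinarith [mul_le_mul_of_nonneg_left (hγ' w) hα0,
      mul_le_mul_of_nonneg_left (hΓsq w) (sq_nonneg α)]
  have hq0 : 0 ≤ q := nonneg_of_mul_nonneg_left ((hnn _).trans (hstep _)) (hpos hw1)
  have hpow (k : ℕ) : (((1 - α • C) ^ k) *ᵥ g) ⬝ᵥ M *ᵥ (((1 - α • C) ^ k) *ᵥ g) ≤
      q ^ k * (g ⬝ᵥ M *ᵥ g) := by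
    induction k with
    | zero => simp
    | succ k ih =>
      rw [pow_succ', ← mulVec_mulVec, pow_succ', mul_assoc]
      exact (hstep _).trans (mul_le_mul_of_nonneg_left ih hq0)
  obtain ⟨v, hv, hr⟩ := exists_mem_krylov_richardson C (B * A μ₁) _ _ hshift g α m
  calc mnorm M (C *ᵥ (u - uhat)) = mnorm M (g - C *ᵥ uhat) := by rw [mulVec_sub, hCu]
    _ ≤ mnorm M (g - C *ᵥ v) := hminz v hv
    _ = mnorm M (((1 - α • C) ^ m) *ᵥ g) := by rw [hr]
    _ ≤ Real.sqrt (q ^ m * (g ⬝ᵥ M *ᵥ g)) := Real.sqrt_le_sqrt (hpow m)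
    _ = q ^ ((m : ℝ) / 2) * mnorm M g := by
      rw [Real.sqrt_mul (pow_nonneg hq0 m), mnorm, Real.sqrt_eq_rpow (q ^ m),
        ← Real.rpow_natCast_mul hq0, mul_one_div]
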